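/- Let (G, ε) be any signed group. Then there does not exist a signed group orthogonal design SOD(6; 2, 2, 2) over (G, ε). -/

import Mathlib

/-- A signed group: a group `G` together with a distinguished central element `ε`
of order two. -/
structure SignedGroup where
  /-- the underlying group -/
  G : Type
  /-- the group structure -/
  grp : Group G
  /-- the distinguished central element -/
  ε : G
  central : ∀ g : G, ε * g = g * ε
  sq : ε * ε = 1
  ne_one : ε ≠ 1

attribute [instance] SignedGroup.grp

namespace SignedGroup

/-- The number of columns `j` in row `a` whose entry is the variable `x i`
(with some signed-group coefficient). -/
noncomputable def rowCount (S : SignedGroup) {n k : ℕ} (X : Fin n → Fin n → Option (S.G × Fin k))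
    (a : Fin n) (i : Fin k) : ℕ :=
  Nat.card {j : Fin n // ∃ g : S.G, X a j = some (g, i)}

/-- `pairCount S X a b i i' g` is the number of columns `j` for which
`X a j = some (s, i)` and `X b j = some (s', i')` with `s * s'⁻¹ = g`. -/
noncomputable def pairCount (S : SignedGroup) {n k : ℕ} (X : Fin n → Fin n → Option (S.G × Fin k))
    (a b : Fin n) (i i' : Fin k) (g : S.G) : ℕ :=
  Nat.card {j : Fin n //
    ∃ s s' : S.G, X a j = some (s, i) ∧ X b j = some (s', i') ∧ s * s'⁻¹ = g}

/-- `X` is a signed group orthogonal design `SOD(n; u 0, …, u (k-1))` over `S`. -/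
def IsSOD (S : SignedGroup) {n k : ℕ} (u : Fin k → ℕ)
    (X : Fin n → Fin n → Option (S.G × Fin k)) : Prop :=
  (∀ (a : Fin n) (i : Fin k), S.rowCount X a i = u i) ∧
  (∀ a b : Fin n, a ≠ b → ∀ (i i' : Fin k) (g : S.G),
    S.pairCount X a b i i' g + S.pairCount X a b i' i g =
      S.pairCount X a b i i' (S.ε * g) + S.pairCount X a b i' i (S.ε * g))

/-- An SOD is full if it has no zero entries. -/
def IsFull (S : SignedGroup) {n k : ℕ} (X : Fin n → Fin n → Option (S.G × Fin k)) : Prop :=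
  ∀ a b : Fin n, X a b ≠ none

end SignedGroup

namespace SignedGroup

/-- Every colour is used in exactly two columns. -/
def IsBalanced {n k : ℕ} (x : Fin n → Fin k) : Prop :=
  ∀ i, ∃ p q, p ≠ q ∧ ∀ j, x j = i ↔ j = p ∨ j = q

/-- The colour pairs of columns `j` and `k` agree up to order. -/
def SamePair {n k : ℕ} (x y : Fin n → Fin k) (j l : Fin n) : Prop :=
  (x l = x j ∧ y l = y j) ∨ (x l = y j ∧ y l = x j)

/-- Every unordered colour pair that occurs in some column occurs in another one. -/
def Compatible {n k : ℕ} (x y : Fin n → Fin k) : Prop :=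
  ∀ j, ∃ l, l ≠ j ∧ SamePair x y j l

/-- The colourings `x` and `y` induce the same partition of the columns. -/
def SameKernel {n k : ℕ} (x y : Fin n → Fin k) : Prop :=
  ∀ j l, x j = x l ↔ y j = y l

/-- The colourings `x` and `y` differ everywhere and no two columns share both colours. -/
def Separated {n k : ℕ} (x y : Fin n → Fin k) : Prop :=
  (∀ j, x j ≠ y j) ∧ ∀ j l, j ≠ l → x j = x l → y j ≠ y l

section Colourings

variable {n : ℕ} {x y z w : Fin n → Fin 3}

theorem SamePair.symm {j l : Fin n} (h : SamePair x y j l) : SamePair y x j l := by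
  unfold SamePair at *
  tauto

theorem Compatible.symm (h : Compatible x y) : Compatible y x := fun j =>
  let ⟨l, hl, hp⟩ := h j
  ⟨l, hl, hp.symm⟩

theorem Separated.symm (h : Separated x y) : Separated y x :=
  ⟨fun j => (h.1 j).symm, fun j l hjl hy hx => h.2 j l hjl hx hy⟩

theorem SameKernel.symm (h : SameKernel x y) : SameKernel y x := fun j l => (h j l).symm

theorem IsBalanced.eq_or_eq (hx : IsBalanced x) {j l m : Fin n} (hjl : j ≠ l)
    (hl : x j = x l) (hm : x m = x j) : m = j ∨ m = l := by
  obtain ⟨p, q, -, h⟩ := hx (x j)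
  have h1 := (h j).1 rfl
  have h2 := (h l).1 hl.symm
  have h3 := (h m).1 hm
  grind

theorem IsBalanced.exists_mate (hx : IsBalanced x) (j : Fin n) : ∃ l, l ≠ j ∧ x l = x j := by
  obtain ⟨p, q, hpq, h⟩ := hx (x j)
  rcases (h j).1 rfl with rfl | rfl
  · exact ⟨q, hpq.symm, (h q).2 (Or.inr rfl)⟩
  · exact ⟨p, hpq, (h p).2 (Or.inl rfl)⟩

theorem eq_of_shared_pair (hx : IsBalanced x) (hy : IsBalanced y) (hxy : Compatible x y)
    {j k l m : Fin n} (hjk : j ≠ k) (hxjk : x j = x k) (hyjk : y j = y k) (hlm : x l = x m) :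
    y l = y m := by
  by_contra hne
  have hlm' : l ≠ m := fun h => hne (h ▸ rfl)
  have hX := fun t => hx.eq_or_eq (m := t) hlm' hlm
  have hXj := fun t => hx.eq_or_eq (m := t) hjk hxjk
  have hYj := fun t => hy.eq_or_eq (m := t) hjk hyjk
  obtain ⟨p, hpl, hp⟩ := hxy l
  obtain ⟨q, hqm, hq⟩ := hxy m
  have three : ∀ a b c d : Fin 3, b ≠ a → c ≠ a → b ≠ c → d = a ∨ d = b ∨ d = c := by decide
  have h1 : x l ≠ x j := by grind
  have h2 : y l ≠ y j := by grind
  have h3 : y m ≠ y j := by grind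
  have h4 := three (y j) (y l) (y m) (x l) h2 h3 hne
  have hp' : x p = y l ∧ y p = x l := by
    rcases hp with hp | hp
    · grind
    · exact hp
  have hq' : x q = y m ∧ y q = x m := by
    rcases hq with hq | hq
    · grind
    · exact hq
  rcases h4 with h | h | h
  · have := hYj p (by grind)
    have := hYj q (by grind)
    grind
  · have := hX p (by grind)
    grind
  · have := hX q (by grind)
    grind

theorem sameKernel_or_separated (hx : IsBalanced x) (hy : IsBalanced y) (hxy : Compatible x y) :
    SameKernel x y ∨ Separated x y := by
  by_cases h : ∃ j k, j ≠ k ∧ x j = x k ∧ y j = y k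
  · obtain ⟨j, k, hjk, h1, h2⟩ := h
    exact Or.inl fun l m => ⟨eq_of_shared_pair hx hy hxy hjk h1 h2,
      eq_of_shared_pair hy hx hxy.symm hjk h2 h1⟩
  · push Not at h
    refine Or.inr ⟨fun j hj => ?_, h⟩
    obtain ⟨l, hl, hp⟩ := hxy j
    refine h l j hl ?_ ?_ <;> rcases hp with hp | hp <;> simp [hp, hj]

theorem eq_of_sameKernel_of_separated (hx : IsBalanced x) (hxy : SameKernel x y)
    (hxz : Separated x z) (hyz : Separated y z) : x = y := by
  funext j
  obtain ⟨l, hl, h⟩ := hx.exists_mate j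
  have h1 := hxz.1 j
  have h2 := hxz.1 l
  have h3 := hyz.1 j
  have h4 := hyz.1 l
  have h5 := hxz.2 l j hl h
  have h6 := (hxy l j).1 h
  rw [h] at h2
  rw [h6] at h4
  have key : ∀ a b c d : Fin 3, a ≠ c → a ≠ d → b ≠ c → b ≠ d → d ≠ c → a = b := by decide
  exact key _ _ _ _ h1 h2 h3 h4 h5

theorem not_four_separated (j : Fin n) (hxy : Separated x y) (hxz : Separated x z)
    (hxw : Separated x w) (hyz : Separated y z) (hyw : Separated y w) (hzw : Separated z w) :
    False := by
  have key : ∀ a b c d : Fin 3, a ≠ b → a ≠ c → a ≠ d → b ≠ c → b ≠ d → c = d := by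
    decide
  exact hzw.1 j (key _ _ _ _ (hxy.1 j) (hxz.1 j) (hxw.1 j) (hyz.1 j) (hyw.1 j))

/-- If `x` and `y` are separated, columns with the same unordered colour pair have their colours
interchanged. -/
theorem Separated.swap (h : Separated x y) {j l : Fin n} (hl : l ≠ j) (hp : SamePair x y j l) :
    x l = y j ∧ y l = x j := by
  rcases hp with hp | hp
  · exact absurd hp.2 (h.2 l j hl hp.1)
  · exact hp

end Colourings

/-- Two rows, with coefficients `s` and `t` and colourings `x` and `y`, are linked: every
column has a partner with the same unordered colour pair and opposite coefficient quotient. -/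
def Linked (S : SignedGroup) {n k : ℕ} (s t : Fin n → S.G) (x y : Fin n → Fin k) : Prop :=
  ∀ j, ∃ l, SamePair x y j l ∧ s l * (t l)⁻¹ = S.ε * (s j * (t j)⁻¹)

section Rows

variable {S : SignedGroup} {n : ℕ}

theorem ε_mul_ne (g : S.G) : S.ε * g ≠ g := by
  simpa using S.ne_one

theorem ε_mul_cancel (g h : S.G) : S.ε * g * (S.ε * h) = g * h := by
  rw [S.central g, mul_assoc, ← mul_assoc S.ε, S.sq, one_mul]

theorem ε_mul_mul_inv (g h : S.G) : S.ε * g * (S.ε * h)⁻¹ = g * h⁻¹ := by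
  rw [S.central g, S.central h]
  group

theorem Linked.exists_ne {k : ℕ} {s t : Fin n → S.G} {x y : Fin n → Fin k} (h : S.Linked s t x y)
    (j : Fin n) :
    ∃ l, l ≠ j ∧ SamePair x y j l ∧ s l * (t l)⁻¹ = S.ε * (s j * (t j)⁻¹) := by
  obtain ⟨l, hp, hl⟩ := h j
  exact ⟨l, fun e => ε_mul_ne _ (hl.symm.trans (by rw [e])), hp, hl⟩

theorem Linked.compatible {k : ℕ} {s t : Fin n → S.G} {x y : Fin n → Fin k}
    (h : S.Linked s t x y) : Compatible x y := fun j =>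
  let ⟨l, hl, hp, _⟩ := h.exists_ne j
  ⟨l, hl, hp⟩

/-- The quotient relation of linked rows whose colourings differ by a translation. -/
theorem Linked.eq_of_translate {s t : Fin n → S.G} {x y : Fin n → Fin 3} (hx : IsBalanced x)
    (h : S.Linked s t x y) {d : Fin 3} (hd : ∀ j, y j = x j + d) {j l : Fin n} (hl : l ≠ j)
    (hxl : x l = x j) : s l * (t l)⁻¹ = S.ε * (s j * (t j)⁻¹) := by
  obtain ⟨m, hm, hp, he⟩ := h.exists_ne j
  have key : ∀ a b d : Fin 3, a = b + d → a + d = b → a = b := by decide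
  have hxm : x m = x j := by
    rcases hp with hp | hp
    · exact hp.1
    · rw [hd, hd] at hp
      exact key _ _ _ hp.1 hp.2
  rcases hx.eq_or_eq hl.symm hxl.symm hxm with rfl | rfl
  · exact absurd rfl hm
  · exact he

/-- No three pairwise linked rows have colourings that differ by translations. -/
theorem not_three_translate {s t u : Fin n → S.G} {x y z : Fin n → Fin 3} (j : Fin n)
    (hx : IsBalanced x) (hy : IsBalanced y) (hst : S.Linked s t x y) (htu : S.Linked t u y z)
    (hsu : S.Linked s u x z) {d e : Fin 3} (hd : ∀ j, y j = x j + d) (he : ∀ j, z j = y j + e) :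
    False := by
  obtain ⟨l, hl, hxl⟩ := hx.exists_mate j
  have h1 := hst.eq_of_translate hx hd hl hxl
  have h2 := htu.eq_of_translate hy he hl (by rw [hd, hd, hxl])
  have h3 := hsu.eq_of_translate (d := d + e) hx (fun j => by rw [he, hd, add_assoc]) hl hxl
  have h4 : s l * (u l)⁻¹ = s j * (u j)⁻¹ := by
    calc s l * (u l)⁻¹ = (s l * (t l)⁻¹) * (t l * (u l)⁻¹) := by group
      _ = (s j * (t j)⁻¹) * (t j * (u j)⁻¹) := by rw [h1, h2, ε_mul_cancel]
      _ = s j * (u j)⁻¹ := by group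
  exact ε_mul_ne _ (h3.symm.trans h4)

/-- Two rows with colouring `x`, both linked to a row with a colouring separated from `x`, have
equal quotients in columns whose colours are interchanged. -/
theorem exists_swap_quotient_eq {s s' t : Fin n → S.G} {x y : Fin n → Fin 3}
    (hxy : Separated x y) (h : S.Linked s t x y) (h' : S.Linked s' t x y) (j : Fin n) :
    ∃ l, x l = y j ∧ y l = x j ∧ s l * (s' l)⁻¹ = s j * (s' j)⁻¹ := by
  obtain ⟨l, hl, hp, he⟩ := h.exists_ne j
  obtain ⟨l', hl', hp', he'⟩ := h'.exists_ne j
  obtain ⟨h1, h2⟩ := hxy.swap hl hp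
  obtain ⟨h1', h2'⟩ := hxy.swap hl' hp'
  have hll : l' = l := by
    by_contra hne
    exact hxy.2 l' l hne (h1'.trans h1.symm) (h2'.trans h2.symm)
  subst hll
  refine ⟨l', h1, h2, ?_⟩
  calc s l' * (s' l')⁻¹ = (s l' * (t l')⁻¹) * (s' l' * (t l')⁻¹)⁻¹ := by group
    _ = (s j * (t j)⁻¹) * (s' j * (t j)⁻¹)⁻¹ := by rw [he, he', ε_mul_mul_inv]
    _ = s j * (s' j)⁻¹ := by group

theorem not_two_equal_of_separated {s s' t u : Fin n → S.G} {x y z : Fin n → Fin 3} (j : Fin n)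
    (hx : IsBalanced x) (hxy : Separated x y) (hxz : Separated x z) (hyz : Separated y z)
    (hss : S.Linked s s' x x) (hst : S.Linked s t x y) (hst' : S.Linked s' t x y)
    (hsu : S.Linked s u x z) (hsu' : S.Linked s' u x z) : False := by
  obtain ⟨k, hk1, hk2, hk⟩ := exists_swap_quotient_eq hxy hst hst' j
  obtain ⟨l, hl1, hl2, hl⟩ := exists_swap_quotient_eq hxz hsu hsu' k
  obtain ⟨m, hm1, hm2, hm⟩ := exists_swap_quotient_eq hxy hst hst' l
  have hj := And.intro (hxy.1 j) (And.intro (hxz.1 j) (hyz.1 j))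
  have hk' := And.intro (hxz.1 k) (hyz.1 k)
  have hl' := And.intro (hxy.1 l) (hyz.1 l)
  have hxl : x l = z j := by omega
  have hxm : x m = x j := by omega
  have hym : y m ≠ y j := by
    rw [hm2, hxl]
    exact hj.2.2.symm
  have hmj : m ≠ j := fun h => hym (h ▸ rfl)
  have h1 := hss.eq_of_translate (d := 0) hx (fun j => (add_zero _).symm) hmj hxm
  exact ε_mul_ne _ (h1.symm.trans (hm.trans (hl.trans hk)))

end Rows

section Families

/-- Two colourings with the same partition and the same orientation differ by a translation. -/
theorem exists_translate_of_orientation {n : ℕ} {w x y : Fin n → Fin 3} {p : Fin 3 → Fin n}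
    (hp : ∀ i, w (p i) = i) (hwx : SameKernel w x) (hwy : SameKernel w y)
    (h : x (p 1) = x (p 0) + 1 ↔ y (p 1) = y (p 0) + 1) : ∃ d, ∀ j, y j = x j + d := by
  have key : ∀ a b c a' b' c' : Fin 3, a ≠ b → a ≠ c → b ≠ c → a' ≠ b' → a' ≠ c' → b' ≠ c' →
      (b = a + 1 ↔ b' = a' + 1) → b' = b + (a' - a) ∧ c' = c + (a' - a) := by decide
  have hx : ∀ i i', i ≠ i' → x (p i) ≠ x (p i') := fun i i' hi e =>
    hi (by rw [← hp i, ← hp i']; exact (hwx _ _).2 e)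
  have hy : ∀ i i', i ≠ i' → y (p i) ≠ y (p i') := fun i i' hi e =>
    hi (by rw [← hp i, ← hp i']; exact (hwy _ _).2 e)
  obtain ⟨h1, h2⟩ := key _ _ _ _ _ _ (hx 0 1 (by decide)) (hx 0 2 (by decide))
    (hx 1 2 (by decide)) (hy 0 1 (by decide)) (hy 0 2 (by decide)) (hy 1 2 (by decide)) h
  refine ⟨y (p 0) - x (p 0), fun j => ?_⟩
  have hxj := (hwx (p (w j)) j).1 (hp _)
  have hyj := (hwy (p (w j)) j).1 (hp _)
  rw [← hxj, ← hyj]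
  generalize w j = i
  fin_cases i
  · simp
  · exact h1
  · exact h2

theorem exists_three_iff (P : Fin 6 → Prop) :
    ∃ a b c : Fin 6, a ≠ b ∧ b ≠ c ∧ a ≠ c ∧ (P a ↔ P b) ∧ (P b ↔ P c) := by
  classical
  obtain ⟨v, hv⟩ := Fintype.exists_lt_card_fiber_of_mul_lt_card (n := 2)
    (fun a => decide (P a)) (by simp)
  obtain ⟨a, ha, b, hb, c, hc, hab, hac, hbc⟩ := Finset.two_lt_card.1 hv
  simp only [Finset.mem_filter, Finset.mem_univ, true_and] at ha hb hc
  refine ⟨a, b, c, hab, hbc, hac, ?_, ?_⟩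
  · rw [← decide_eq_decide, ha, hb]
  · rw [← decide_eq_decide, hb, hc]

/-- If a symmetric relation on six points relates two points but has no path on three points,
then it relates some point to another, and that point and two further points are pairwise unrelated. -/
theorem exists_pair_and_two_others (r : Fin 6 → Fin 6 → Prop) (symm : ∀ a b, r a b → r b a)
    (h3 : ∀ a b c, a ≠ b → b ≠ c → a ≠ c → r a b → r b c → False)
    (hex : ∃ a b, a ≠ b ∧ r a b) :
    ∃ a a' b c, a ≠ a' ∧ r a a' ∧ ¬ r a b ∧ ¬ r a c ∧ ¬ r b c := by
  obtain ⟨a, a', haa, hr⟩ := hex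
  have hcard : 3 ≤ (Finset.univ \ {a, a'} : Finset (Fin 6)).card := by
    have := Finset.le_card_sdiff {a, a'} (Finset.univ : Finset (Fin 6))
    rw [Finset.card_pair haa] at this
    simp at this
    omega
  obtain ⟨b, hb, c, hc, d, hd, hbc, hbd, hcd⟩ := Finset.two_lt_card.1 hcard
  simp only [Finset.mem_sdiff, Finset.mem_univ, true_and, Finset.mem_insert,
    Finset.mem_singleton, not_or] at hb hc hd
  have hout : ∀ e, e ≠ a → e ≠ a' → ¬ r a e := fun e h h' hre =>
    h3 a' a e haa.symm h.symm h'.symm (symm _ _ hr) hre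
  by_cases hrbc : r b c
  · refine ⟨a, a', b, d, haa, hr, hout b hb.1 hb.2, hout d hd.1 hd.2, fun hrbd => ?_⟩
    exact h3 c b d hbc.symm hbd hcd (symm _ _ hrbc) hrbd
  · exact ⟨a, a', b, c, haa, hr, hout b hb.1 hb.2, hout c hc.1 hc.2, hrbc⟩

theorem not_forall_linked (S : SignedGroup) (s : Fin 6 → Fin 6 → S.G) (f : Fin 6 → Fin 6 → Fin 3)
    (hf : ∀ a, IsBalanced (f a)) (hl : ∀ a b, a ≠ b → S.Linked (s a) (s b) (f a) (f b)) :
    False := by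
  have hdich : ∀ a b, ¬ SameKernel (f a) (f b) → Separated (f a) (f b) := fun a b h => by
    have hab : a ≠ b := by
      rintro rfl
      exact h fun _ _ => Iff.rfl
    exact (sameKernel_or_separated (hf a) (hf b) (hl a b hab).compatible).resolve_left h
  have htrans : ∀ a b c, SameKernel (f a) (f b) → SameKernel (f b) (f c) →
      SameKernel (f a) (f c) := fun a b c h h' j l => (h j l).trans (h' j l)
  by_cases hall : ∀ a, SameKernel (f 0) (f a)
  · have hp : ∀ i, ∃ j, f 0 j = i := fun i =>
      let ⟨p, _, _, h⟩ := hf 0 i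
      ⟨p, (h p).2 (Or.inl rfl)⟩
    choose p hp using hp
    obtain ⟨a, b, c, hab, hbc, hac, h1, h2⟩ :=
      exists_three_iff fun a => f a (p 1) = f a (p 0) + 1
    obtain ⟨d, hd⟩ := exists_translate_of_orientation hp (hall a) (hall b) h1
    obtain ⟨e, he⟩ := exists_translate_of_orientation hp (hall b) (hall c) h2
    exact not_three_translate 0 (hf a) (hf b) (hl a b hab) (hl b c hbc) (hl a c hac) hd he
  · push Not at hall
    obtain ⟨o, ho⟩ := hall
    have heq : ∀ a b, SameKernel (f a) (f b) → f a = f b := fun a b h => by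
      obtain ⟨e, he⟩ : ∃ e, ¬ SameKernel (f a) (f e) := by
        by_contra! hcon
        exact ho (htrans _ _ _ (hcon 0).symm (hcon o))
      refine eq_of_sameKernel_of_separated (hf a) h (hdich a e he) (hdich b e fun h' => ?_)
      exact he (htrans _ _ _ h h')
    obtain ⟨a, a', b, c, haa, hr, hab, hac, hbc⟩ :=
      exists_pair_and_two_others (fun a b => SameKernel (f a) (f b)) (fun _ _ h => h.symm)
        (fun a b c hab hbc hac h h' =>
          not_three_translate (d := 0) (e := 0) 0 (hf a) (hf b) (hl a b hab) (hl b c hbc)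
            (hl a c hac) (fun j => by rw [heq a b h, add_zero])
            (fun j => by rw [heq b c h', add_zero]))
        (by
          by_contra! hcon
          have hs : ∀ a b, a ≠ b → Separated (f a) (f b) := fun a b h => hdich a b (hcon a b h)
          exact not_four_separated 0 (hs 0 1 (by decide)) (hs 0 2 (by decide))
            (hs 0 3 (by decide)) (hs 1 2 (by decide)) (hs 1 3 (by decide)) (hs 2 3 (by decide)))
    have e := heq a a' hr
    have ne_of : ∀ {u v}, ¬ SameKernel (f u) (f v) → u ≠ v := by
      rintro u v h rfl
      exact h fun _ _ => Iff.rfl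
    have hab' : ¬ SameKernel (f a') (f b) := e ▸ hab
    have hac' : ¬ SameKernel (f a') (f c) := e ▸ hac
    refine not_two_equal_of_separated (s' := s a') 0 (hf a) (hdich a b hab) (hdich a c hac)
      (hdich b c hbc) ?_ (hl a b (ne_of hab)) ?_ (hl a c (ne_of hac)) ?_
    · simpa only [← e] using hl a a' haa
    · simpa only [← e] using hl a' b (ne_of hab')
    · simpa only [← e] using hl a' c (ne_of hac')

end Families

section Design

variable {S : SignedGroup} {X : Fin 6 → Fin 6 → Option (S.G × Fin 3)}

theorem IsSOD.exists_entry (h : S.IsSOD ![2, 2, 2] X) (a j : Fin 6) :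
    ∃ e : S.G × Fin 3, X a j = some e := by
  classical
  have hc : ∀ i, (Finset.univ.filter fun j => (X a j).map Prod.snd = some i).card = 2 := by
    intro i
    have h1 : S.rowCount X a i = 2 := by
      rw [h.1 a i]
      fin_cases i <;> rfl
    rw [rowCount, Nat.card_eq_fintype_card, Fintype.card_subtype] at h1
    rw [← h1]
    congr 1
    ext j
    simp
  have hsum := Finset.card_eq_sum_card_fiberwise (s := (Finset.univ : Finset (Fin 6)))
    (t := Finset.univ) (f := fun j => (X a j).map Prod.snd) (fun _ _ => Finset.mem_univ _)
  rw [Fintype.sum_option, Fin.sum_univ_three, hc, hc, hc, Finset.card_univ,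
    Fintype.card_fin] at hsum
  have h0 : (Finset.univ.filter fun j => (X a j).map Prod.snd = none).card = 0 := by omega
  rw [Finset.card_eq_zero, Finset.filter_eq_empty_iff] at h0
  have := h0 (Finset.mem_univ j)
  exact Option.ne_none_iff_exists'.1 (by simpa using this)

theorem IsSOD.linked {s : Fin 6 → Fin 6 → S.G} {f : Fin 6 → Fin 6 → Fin 3} {u : Fin 3 → ℕ}
    (h : S.IsSOD u X) (hX : ∀ a j, X a j = some (s a j, f a j)) {a b : Fin 6} (hab : a ≠ b) :
    S.Linked (s a) (s b) (f a) (f b) := by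
  intro j
  have h1 := h.2 a b hab (f a j) (f b j) (s a j * (s b j)⁻¹)
  have hpos : 0 < S.pairCount X a b (f a j) (f b j) (s a j * (s b j)⁻¹) :=
    Nat.card_pos_iff.2 ⟨⟨⟨j, _, _, hX a j, hX b j, rfl⟩⟩, inferInstance⟩
  have hex : ∀ i i' g, 0 < S.pairCount X a b i i' g →
      ∃ l, f a l = i ∧ f b l = i' ∧ s a l * (s b l)⁻¹ = g := by
    intro i i' g hg
    obtain ⟨⟨l, t, t', ht, ht', hg⟩⟩ := (Nat.card_pos_iff.1 hg).1
    rw [hX, Option.some.injEq, Prod.mk.injEq] at ht ht'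
    exact ⟨l, ht.2, ht'.2, by rw [ht.1, ht'.1, hg]⟩
  rcases Nat.eq_zero_or_pos (S.pairCount X a b (f a j) (f b j) (S.ε * (s a j * (s b j)⁻¹)))
    with h0 | h0
  · obtain ⟨l, h1, h2, h3⟩ := hex (f b j) (f a j) (S.ε * (s a j * (s b j)⁻¹)) (by omega)
    exact ⟨l, Or.inr ⟨h1, h2⟩, h3⟩
  · obtain ⟨l, h1, h2, h3⟩ := hex _ _ _ h0
    exact ⟨l, Or.inl ⟨h1, h2⟩, h3⟩

theorem IsSOD.isBalanced {s : Fin 6 → Fin 6 → S.G} {f : Fin 6 → Fin 6 → Fin 3}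
    (h : S.IsSOD ![2, 2, 2] X) (hX : ∀ a j, X a j = some (s a j, f a j)) (a : Fin 6) :
    IsBalanced (f a) := by
  classical
  intro i
  have h1 : S.rowCount X a i = 2 := by
    rw [h.1 a i]
    fin_cases i <;> rfl
  rw [rowCount, Nat.card_eq_fintype_card, Fintype.card_subtype, Finset.card_eq_two] at h1
  obtain ⟨p, q, hpq, hset⟩ := h1
  refine ⟨p, q, hpq, fun j => ?_⟩
  have := Finset.ext_iff.1 hset j
  simpa [hX] using this

end Design

end SignedGroup

/-- There does not exist any `SOD(6; 2, 2, 2)` over any signed group. -/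
theorem no_SOD_6_2_2_2 (S : SignedGroup) :
    ¬ ∃ X : Fin 6 → Fin 6 → Option (S.G × Fin 3), S.IsSOD ![2, 2, 2] X := by
  rintro ⟨X, hX⟩
  choose e he using hX.exists_entry
  exact SignedGroup.not_forall_linked S (fun a j => (e a j).1) (fun a j => (e a j).2)
    (hX.isBalanced he) fun _ _ hab => hX.linked he hab
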